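/- Let u : [0,1] → 𝔤, ν : [0,1] → V, m : [0,1] → V* be continuous and let μ : [0,1] → 𝔤*, σ : [0,1] → V*, n : [0,1] → V be continuously differentiable curves satisfying, for every t ∈ [0,1], the metamorphosis Euler–Poincaré system: μ'(t) + ad*_{u(t)} μ(t) + m(t) ⋄ n(t) + σ(t) ⋄ ν(t) = 0, σ'(t) + u(t) ⋆ σ(t) − m(t) = 0, and n'(t) = ν(t) + u(t)·n(t). If the endpoint condition μ(1) + σ(1) ⋄ n(1) = 0 holds, then μ(t) + σ(t) ⋄ n(t) = 0 for all t ∈ [0,1]; that is, the zero level set of the momentum map μ + σ ⋄ n is preserved by coadjoint motion. -/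

import Mathlib

open Module Set

variable {G V : Type*}
  [NormedAddCommGroup G] [NormedSpace ℝ G] [FiniteDimensional ℝ G]
  [NormedAddCommGroup V] [NormedSpace ℝ V] [FiniteDimensional ℝ V]

/-- The diamond operator `⋄ : V* × V → 𝔤*`, `⟨σ ⋄ v, u⟩ = -⟨σ, u·v⟩`, where the
`𝔤`-action on `V` is given by the bilinear map `ρ`. -/
noncomputable def dia (ρ : G →ₗ[ℝ] V →ₗ[ℝ] V) (σ : V →L[ℝ] ℝ) (v : V) : G →L[ℝ] ℝ :=
  LinearMap.toContinuousLinearMap (-((σ : V →ₗ[ℝ] ℝ) ∘ₗ (ρ.flip v)))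

/-- The star operator `⋆ : 𝔤 × V* → V*`, `⟨u ⋆ σ, v⟩ = ⟨σ, u·v⟩`. -/
noncomputable def starOp (ρ : G →ₗ[ℝ] V →ₗ[ℝ] V) (u : G) (σ : V →L[ℝ] ℝ) : V →L[ℝ] ℝ :=
  LinearMap.toContinuousLinearMap ((σ : V →ₗ[ℝ] ℝ) ∘ₗ (ρ u))

/-- The coadjoint operator `ad*_u : 𝔤* → 𝔤*`, `⟨ad*_u μ, ξ⟩ = ⟨μ, [u, ξ]⟩`, where the
Lie bracket on `𝔤` is given by the bilinear map `bra`. -/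
noncomputable def coad (bra : G →ₗ[ℝ] G →ₗ[ℝ] G) (u : G) (μ : G →L[ℝ] ℝ) : G →L[ℝ] ℝ :=
  LinearMap.toContinuousLinearMap ((μ : G →ₗ[ℝ] ℝ) ∘ₗ (bra u))

/-- A bilinear map between finite-dimensional spaces is continuous in each argument, and hence
factors through the continuous linear maps. -/
theorem exists_continuousLinearMap_eq_bilin {E F H : Type*}
    [NormedAddCommGroup E] [NormedSpace ℝ E] [FiniteDimensional ℝ E]
    [NormedAddCommGroup F] [NormedSpace ℝ F] [FiniteDimensional ℝ F]
    [NormedAddCommGroup H] [NormedSpace ℝ H] (b : E →ₗ[ℝ] F →ₗ[ℝ] H) :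
    ∃ B : E →L[ℝ] F →L[ℝ] H, ∀ x y, B x y = b x y :=
  ⟨LinearMap.toContinuousLinearMap
    ((LinearMap.toContinuousLinearMap : (F →ₗ[ℝ] H) ≃ₗ[ℝ] F →L[ℝ] H).toLinearMap ∘ₗ b),
    fun _ _ => rfl⟩

theorem dia_apply (ρ : G →ₗ[ℝ] V →ₗ[ℝ] V) (σ : V →L[ℝ] ℝ) (v : V) (x : G) :
    dia ρ σ v x = -σ (ρ x v) := rfl

theorem starOp_apply (ρ : G →ₗ[ℝ] V →ₗ[ℝ] V) (u : G) (σ : V →L[ℝ] ℝ) (v : V) :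
    starOp ρ u σ v = σ (ρ u v) := rfl

theorem coad_apply (bra : G →ₗ[ℝ] G →ₗ[ℝ] G) (u : G) (μ : G →L[ℝ] ℝ) (x : G) :
    coad bra u μ x = μ (bra u x) := rfl

theorem HasDerivWithinAt.dia (ρ : G →ₗ[ℝ] V →ₗ[ℝ] V) {σ : ℝ → V →L[ℝ] ℝ} {n : ℝ → V}
    {σ' : V →L[ℝ] ℝ} {n' : V} {s : Set ℝ} {t : ℝ}
    (hσ : HasDerivWithinAt σ σ' s t) (hn : HasDerivWithinAt n n' s t) :
    HasDerivWithinAt (fun t => dia ρ (σ t) (n t)) (dia ρ σ' (n t) + dia ρ (σ t) n') s t := by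
  obtain ⟨R, hR⟩ := exists_continuousLinearMap_eq_bilin ρ.flip
  have key (τ : V →L[ℝ] ℝ) (v : V) : _root_.dia ρ τ v = -(τ.comp (R v)) := by
    ext x
    simp [dia_apply, hR]
  simp only [key, ← neg_add]
  exact (hσ.clm_comp (R.hasFDerivAt.comp_hasDerivWithinAt t hn)).fun_neg

theorem exists_lipschitzWith_neg_coad (bra : G →ₗ[ℝ] G →ₗ[ℝ] G) {u : ℝ → G} {s : Set ℝ}
    (hs : IsCompact s) (hu : ContinuousOn u s) :
    ∃ K : NNReal, ∀ t ∈ s, LipschitzWith K (fun μ => -coad bra (u t) μ) := by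
  obtain ⟨B, hB⟩ := exists_continuousLinearMap_eq_bilin bra
  obtain ⟨C, hC⟩ := hs.exists_bound_of_continuousOn (B.continuous.comp_continuousOn hu)
  refine ⟨C.toNNReal, fun t ht => LipschitzWith.of_dist_le_mul fun μ₁ μ₂ => ?_⟩
  have key (μ : G →L[ℝ] ℝ) : coad bra (u t) μ = μ.comp (B (u t)) := by
    ext x
    simp [coad_apply, hB]
  rw [dist_neg_neg, key, key, dist_eq_norm, dist_eq_norm, ← ContinuousLinearMap.sub_comp,
    mul_comm]
  refine (ContinuousLinearMap.opNorm_comp_le _ _).trans ?_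
  gcongr
  exact (hC t ht).trans (Real.le_coe_toNNReal C)

/-- If the metamorphosis Euler–Poincaré system holds on `[0,1]` and the momentum map
`μ + σ ⋄ n` vanishes at the endpoint `t = 1`, then it vanishes for all `t ∈ [0,1]`:
the zero level set of the momentum map is preserved by coadjoint motion. -/
theorem momentum_zero_level_preserved
    (bra : G →ₗ[ℝ] G →ₗ[ℝ] G)
    (hskew : ∀ x : G, bra x x = 0)
    (hjac : ∀ x y z : G, bra x (bra y z) + bra y (bra z x) + bra z (bra x y) = 0)
    (ρ : G →ₗ[ℝ] V →ₗ[ℝ] V)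
    (hrep : ∀ (x y : G) (v : V), ρ (bra x y) v = ρ x (ρ y v) - ρ y (ρ x v))
    (u : ℝ → G) (ν : ℝ → V) (m : ℝ → V →L[ℝ] ℝ)
    (hu : ContinuousOn u (Icc 0 1)) (hν : ContinuousOn ν (Icc 0 1))
    (hm : ContinuousOn m (Icc 0 1))
    (μ : ℝ → G →L[ℝ] ℝ) (σ : ℝ → V →L[ℝ] ℝ) (n : ℝ → V)
    (hμ : ContDiffOn ℝ 1 μ (Icc 0 1)) (hσ : ContDiffOn ℝ 1 σ (Icc 0 1))
    (hn : ContDiffOn ℝ 1 n (Icc 0 1))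
    (heq1 : ∀ t ∈ Icc (0:ℝ) 1, derivWithin μ (Icc 0 1) t + coad bra (u t) (μ t)
        + dia ρ (m t) (n t) + dia ρ (σ t) (ν t) = 0)
    (heq2 : ∀ t ∈ Icc (0:ℝ) 1, derivWithin σ (Icc 0 1) t + starOp ρ (u t) (σ t) - m t = 0)
    (heq3 : ∀ t ∈ Icc (0:ℝ) 1, derivWithin n (Icc 0 1) t = ν t + ρ (u t) (n t))
    (hend : μ 1 + dia ρ (σ 1) (n 1) = 0) :
    ∀ t ∈ Icc (0:ℝ) 1, μ t + dia ρ (σ t) (n t) = 0 := by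
  obtain ⟨K, hK⟩ := exists_lipschitzWith_neg_coad bra isCompact_Icc hu
  have hderiv : ∀ t ∈ Icc (0 : ℝ) 1, HasDerivWithinAt (fun t => μ t + dia ρ (σ t) (n t))
      (-coad bra (u t) (μ t + dia ρ (σ t) (n t))) (Icc 0 1) t := by
    intro t ht
    have hμ' := (hμ.differentiableOn one_ne_zero t ht).hasDerivWithinAt
    have hσ' := (hσ.differentiableOn one_ne_zero t ht).hasDerivWithinAt
    have hn' := (hn.differentiableOn one_ne_zero t ht).hasDerivWithinAt
    refine (hμ'.fun_add (hσ'.dia ρ hn')).congr_deriv ?_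
    ext x
    have e1 := DFunLike.congr_fun (heq1 t ht) x
    have e2 := DFunLike.congr_fun (heq2 t ht) (ρ x (n t))
    simp only [add_apply, sub_apply,
      neg_apply, zero_apply, dia_apply, starOp_apply,
      coad_apply, heq3 t ht, hrep, map_add, map_sub] at e1 e2 ⊢
    linarith
  have huniq : EqOn (fun t => μ t + dia ρ (σ t) (n t)) (fun _ => 0) (Icc 0 1) :=
    ODE_solution_unique_of_mem_Icc_left (v := fun t μ => -coad bra (u t) μ)
      (s := fun _ => univ) (K := K)
      (fun t ht => (hK t (Ioc_subset_Icc_self ht)).lipschitzOnWith)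
      (fun t ht => (hderiv t ht).continuousWithinAt)
      (fun t ht => (hderiv t (Ioc_subset_Icc_self ht)).mono_of_mem_nhdsWithin
        (Icc_mem_nhdsLE_of_mem ht))
      (fun _ _ => mem_univ _) continuousOn_const
      (fun t _ => by
        have h : -coad bra (u t) 0 = 0 := by
          ext x
          simp [coad_apply]
        rw [h]
        exact hasDerivWithinAt_const ..)
      (fun _ _ => mem_univ _) hend
  exact fun t ht => huniq ht
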